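/- Let g be a matrix over ℚ_p indexed by Fin α ⊕ Fin N with blocks a,b,c,d, and let u : Matrix (Fin N) (Fin N) ℚ_p be invertible with all entries of u and of u⁻¹ of p-adic norm at most 1 (i.e., u ∈ GL(N, ℤ_p)). Let g' be the block matrix with blocks a, b*u⁻¹, u*c, u*d*u⁻¹ (the conjugate of g by Matrix.fromBlocks 1 0 0 u). Then for every lattice R in Fin 2 → ℚ_p, χ_{g'}(R) = χ_g(R): the lattice-valued characteristic function depends only on the conjugacy class of g under GL(N, ℤ_p). -/

import Mathlib

open Matrix

/-- A lattice in a finite-dimensional `ℚ_[p]`-vector space: a subset which is closed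
under addition and under multiplication by scalars from `ℤ_[p]` (coerced into `ℚ_[p]`),
is compact, and whose `ℚ_[p]`-linear span is the whole space. -/
def IsLattice (p : ℕ) [Fact p.Prime] {V : Type*} [AddCommGroup V] [Module ℚ_[p] V]
    [TopologicalSpace V] (R : Set V) : Prop :=
  (∀ x ∈ R, ∀ y ∈ R, x + y ∈ R) ∧
  (∀ (c : ℤ_[p]), ∀ x ∈ R, ((c : ℚ_[p]) • x) ∈ R) ∧
  IsCompact R ∧
  Submodule.span ℚ_[p] R = ⊤

variable {p : ℕ} [Fact p.Prime]

/-- `R ⊗ 𝕆^N`: the `ℤ_[p]`-submodule of `(Fin N → ℚ_[p]) × (Fin N → ℚ_[p])` spanned by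
the vectors `(r 0 • v, r 1 • v)` with `r ∈ R` and `v` having all coordinates in `ℤ_[p]`. -/
noncomputable def tensO {N : ℕ} (R : Set (Fin 2 → ℚ_[p])) :
    Submodule ℤ_[p] ((Fin N → ℚ_[p]) × (Fin N → ℚ_[p])) :=
  Submodule.span ℤ_[p]
    {w | ∃ r ∈ R, ∃ v : Fin N → ℚ_[p], (∀ i, ‖v i‖ ≤ 1) ∧ w = (r 0 • v, r 1 • v)}

/-- The lattice-valued characteristic function `χ_g(R)` of a colligation `g` over `ℚ_[p]`. -/
def chiLat {α N : ℕ} (g : Matrix (Fin α ⊕ Fin N) (Fin α ⊕ Fin N) ℚ_[p])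
    (R : Set (Fin 2 → ℚ_[p])) : Set ((Fin α → ℚ_[p]) × (Fin α → ℚ_[p])) :=
  {qp | ∃ x y : Fin N → ℚ_[p], (y, x) ∈ tensO (p := p) R ∧
    qp.1 = g.toBlocks₁₁.mulVec qp.2 + g.toBlocks₁₂.mulVec x ∧
    y = g.toBlocks₂₁.mulVec qp.2 + g.toBlocks₂₂.mulVec x}

/-- A matrix with integral entries maps integral vectors to integral vectors. -/
theorem norm_mulVec_apply_le_one {m n : Type*} [Fintype n] {u : Matrix m n ℚ_[p]}
    (hu : ∀ i j, ‖u i j‖ ≤ 1) {v : n → ℚ_[p]} (hv : ∀ j, ‖v j‖ ≤ 1) (i : m) :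
    ‖(u *ᵥ v) i‖ ≤ 1 :=
  IsUltrametricDist.norm_sum_le_of_forall_le_of_nonneg zero_le_one fun j _ => by
    rw [norm_mul]
    exact mul_le_one₀ (hu i j) (norm_nonneg _) (hv j)

/-- `R ⊗ 𝕆^N` is stable under the diagonal action of matrices with integral entries. -/
theorem mulVec_mem_tensO {N : ℕ} {R : Set (Fin 2 → ℚ_[p])} {u : Matrix (Fin N) (Fin N) ℚ_[p]}
    (hu : ∀ i j, ‖u i j‖ ≤ 1) {w : (Fin N → ℚ_[p]) × (Fin N → ℚ_[p])} (hw : w ∈ tensO R) :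
    (u *ᵥ w.1, u *ᵥ w.2) ∈ tensO R := by
  induction hw using Submodule.span_induction with
  | mem w hw =>
    obtain ⟨r, hr, v, hv, rfl⟩ := hw
    exact Submodule.subset_span
      ⟨r, hr, u *ᵥ v, norm_mulVec_apply_le_one hu hv, by simp [mulVec_smul]⟩
  | zero => simp [Prod.mk_zero_zero]
  | add w z _ _ hw hz => simpa [mulVec_add] using add_mem hw hz
  | smul c w _ hw => simpa [mulVec_smul] using Submodule.smul_mem _ c hw

/-- The lattice-valued characteristic function depends only on the conjugacy class of the
colligation under `GL(N, ℤ_p)`. -/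
theorem chiLat_conj_invariant {α N : ℕ}
    (g : Matrix (Fin α ⊕ Fin N) (Fin α ⊕ Fin N) ℚ_[p])
    (u : Matrix (Fin N) (Fin N) ℚ_[p]) (hu : IsUnit u)
    (hu1 : ∀ i j, ‖u i j‖ ≤ 1) (hu2 : ∀ i j, ‖u⁻¹ i j‖ ≤ 1)
    (g' : Matrix (Fin α ⊕ Fin N) (Fin α ⊕ Fin N) ℚ_[p])
    (hg' : g' = Matrix.fromBlocks g.toBlocks₁₁ (g.toBlocks₁₂ * u⁻¹)
      (u * g.toBlocks₂₁) (u * g.toBlocks₂₂ * u⁻¹)) :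
    ∀ R : Set (Fin 2 → ℚ_[p]), IsLattice p R → chiLat g' R = chiLat g R := by
  have hdet := u.isUnit_iff_isUnit_det.mp hu
  subst hg'
  rintro R -
  ext ⟨q, r⟩
  simp only [chiLat, Set.mem_ofPred_eq, toBlocks_fromBlocks₁₁, toBlocks_fromBlocks₁₂,
    toBlocks_fromBlocks₂₁, toBlocks_fromBlocks₂₂]
  constructor
  · rintro ⟨x, y, hxy, hq, hy⟩
    refine ⟨u⁻¹ *ᵥ x, u⁻¹ *ᵥ y, mulVec_mem_tensO hu2 hxy, ?_, ?_⟩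
    · rw [hq, mulVec_mulVec]
    · rw [hy, mulVec_add, mulVec_mulVec, mulVec_mulVec, mulVec_mulVec, Matrix.mul_assoc u,
        nonsing_inv_mul_cancel_left _ _ hdet, nonsing_inv_mul_cancel_left _ _ hdet]
  · rintro ⟨x, y, hxy, hq, hy⟩
    refine ⟨u *ᵥ x, u *ᵥ y, mulVec_mem_tensO hu1 hxy, ?_, ?_⟩
    · rw [hq, mulVec_mulVec, nonsing_inv_mul_cancel_right _ _ hdet]
    · rw [hy, mulVec_add, mulVec_mulVec, mulVec_mulVec, mulVec_mulVec,
        nonsing_inv_mul_cancel_right _ _ hdet]
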